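/- For all reals C > 0 and δ ∈ (0,1) there exists a constant ρ > 0 such that the following holds. Let G = (V,E) be a finite simple graph and λ > 0 a fugacity such that the hardcore model on G satisfies strong spatial mixing with parameters (C, δ). Then for every nonempty S ⊆ U ⊆ V, every real γ ≥ 10, and every integer r ≥ ρ(log|S| + log γ), every function f : {0,1}^V → ℝ≥0 satisfies E[Ent_U f] ≤ e^{1/γ} · (E[Ent_{B_U(S,r)} f] + E[Ent_{U∖S} f]). -/

import Mathlib

open scoped BigOperators Classical

noncomputable section

/-- Expectation of `f` under the (finitely supported) density `p`. -/
def pmean {α : Type*} [Fintype α] (p f : α → ℝ) : ℝ := ∑ a, p a * f a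

/-- Variance of `f` under the density `p`. -/
def pvar {α : Type*} [Fintype α] (p f : α → ℝ) : ℝ :=
  pmean p (fun a => (f a - pmean p f) ^ 2)

/-- Entropy of `f` under the density `p` (with the convention `0 log 0 = 0`,
which is automatic since `Real.log 0 = 0`). -/
def pent {α : Type*} [Fintype α] (p f : α → ℝ) : ℝ :=
  pmean p (fun a => f a * Real.log (f a)) - pmean p f * Real.log (pmean p f)

/-- Total variation distance between two densities. -/
def ptv {α : Type*} [Fintype α] (p q : α → ℝ) : ℝ := (1 / 2) * ∑ a, |p a - q a|

variable {V : Type*} [Fintype V] [DecidableEq V]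

/-- `σ : V → Bool` is the indicator of an independent set of `G`. -/
def isIndep (G : SimpleGraph V) (σ : V → Bool) : Prop :=
  ∀ u v, G.Adj u v → ¬(σ u = true ∧ σ v = true)

/-- Hardcore weight: `λ^{|σ|}` on independent-set indicators, `0` otherwise. -/
def hcW (G : SimpleGraph V) (lam : ℝ) (σ : V → Bool) : ℝ :=
  if isIndep G σ then lam ^ (Finset.univ.filter (fun v => σ v = true)).card else 0

/-- The hardcore Gibbs distribution with fugacity `lam` on `G`. -/
def hcMu (G : SimpleGraph V) (lam : ℝ) : (V → Bool) → ℝ :=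
  fun σ => hcW G lam σ / ∑ τ, hcW G lam τ

/-- Probability, under the density `μ`, of agreeing with `η` on the set `Λ`. -/
def prAgree (μ : (V → Bool) → ℝ) (Λ : Finset V) (η : V → Bool) : ℝ :=
  ∑ τ ∈ Finset.univ.filter (fun τ : V → Bool => ∀ v ∈ Λ, τ v = η v), μ τ

/-- The conditional density of `μ` given that the configuration agrees with `σ`
outside the (free) set `B`. -/
def condD (μ : (V → Bool) → ℝ) (B : Finset V) (σ : V → Bool) : (V → Bool) → ℝ :=
  fun τ => if ∀ v, v ∉ B → τ v = σ v
    then μ τ / ∑ τ' ∈ Finset.univ.filter (fun τ' : V → Bool => ∀ v, v ∉ B → τ' v = σ v), μ τ'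
    else 0

/-- The marginal probability, under the density `p`, that vertex `v` has spin `c`. -/
def vmarg {V : Type*} [Fintype V] [DecidableEq V]
    (p : (V → Bool) → ℝ) (v : V) (c : Bool) : ℝ :=
  ∑ τ ∈ Finset.univ.filter (fun τ : V → Bool => τ v = c), p τ

/-- `B_U(S, r) = {v ∈ U : dist_G(v, S) ≤ r}` (via walks, so that unreachable vertices
are excluded). -/
def ballUr {V : Type*} [Fintype V] [DecidableEq V] (G : SimpleGraph V)
    (U S : Finset V) (r : ℕ) : Finset V :=
  U.filter (fun v => ∃ s ∈ S, ∃ w : G.Walk v s, w.length ≤ r)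

/-- **Strong spatial mixing with exponential decay rate** for the hardcore model on `G`
with fugacity `lam`, with parameters `Cssm > 0` and `δ ∈ (0,1)`: for every pinning `η`
on `Λ`, every vertex `v ∉ Λ`, every feasible spin `c`, every `W ⊆ V∖Λ∖{v}` and any two
feasible pinnings `τ, ξ` on `W`,
`|μ^η_v(c | τ)/μ^η_v(c | ξ) − 1| ≤ Cssm (1−δ)^{dist_G(v, W)}`.
(The pinnings `η∪τ` and `η∪ξ` are represented by configurations `θ₁, θ₂` agreeing on
`Λ`, and `dist_G(v, W) ≥ d` is expressed by quantifying over all `d : ℕ` such that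
every walk from `v` to `W` has length at least `d`.) -/
def hcSSM {V : Type*} [Fintype V] [DecidableEq V]
    (G : SimpleGraph V) (lam Cssm δ : ℝ) : Prop :=
  ∀ (Λ W : Finset V) (v : V), v ∉ Λ → v ∉ W → Disjoint Λ W →
    ∀ θ₁ θ₂ : V → Bool, (∀ u ∈ Λ, θ₁ u = θ₂ u) →
      0 < prAgree (hcMu G lam) (Λ ∪ W) θ₁ →
      0 < prAgree (hcMu G lam) (Λ ∪ W) θ₂ →
      ∀ c : Bool, 0 < vmarg (condD (hcMu G lam) Λᶜ θ₁) v c →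
      ∀ d : ℕ, (∀ u ∈ W, ∀ w : G.Walk v u, d ≤ w.length) →
        |vmarg (condD (hcMu G lam) (Λ ∪ W)ᶜ θ₁) v c /
            vmarg (condD (hcMu G lam) (Λ ∪ W)ᶜ θ₂) v c - 1| ≤
          Cssm * (1 - δ) ^ d

/-! ### Conditional expectations on finite configuration spaces -/

section CondExp

variable {μ : (V → Bool) → ℝ} {B B' : Finset V}

/-- The conditional expectation of `f` given the configuration outside `B`. -/
def condMean (μ : (V → Bool) → ℝ) (B : Finset V) (f : (V → Bool) → ℝ) : (V → Bool) → ℝ :=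
  fun σ => pmean (condD μ B σ) f

/-- The function `f` does not depend on the coordinates in `B`. -/
def IsOutside (B : Finset V) (f : (V → Bool) → ℝ) : Prop :=
  ∀ σ τ : V → Bool, (∀ v, v ∉ B → τ v = σ v) → f τ = f σ

lemma IsOutside.mono {V : Type*} {B B' : Finset V} {f : (V → Bool) → ℝ} (h : IsOutside B' f) (hB : B ⊆ B') :
    IsOutside B f :=
  fun σ τ hστ => h σ τ fun v hv => hστ v fun hvB => hv (hB hvB)

lemma prAgree_nonneg (hμ : ∀ σ, 0 ≤ μ σ) (Λ : Finset V) (σ : V → Bool) :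
    0 ≤ prAgree μ Λ σ :=
  Finset.sum_nonneg fun τ _ => hμ τ

lemma prAgree_anti (hμ : ∀ σ, 0 ≤ μ σ) {Λ Λ' : Finset V} (h : Λ ⊆ Λ') (σ : V → Bool) :
    prAgree μ Λ' σ ≤ prAgree μ Λ σ := by
  refine Finset.sum_le_sum_of_subset_of_nonneg ?_ fun τ _ _ => hμ τ
  intro τ hτ
  simp only [Finset.mem_filter, Finset.mem_univ, true_and] at hτ ⊢
  exact fun v hv => hτ v (h hv)

lemma le_prAgree (hμ : ∀ σ, 0 ≤ μ σ) (Λ : Finset V) (σ : V → Bool) :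
    μ σ ≤ prAgree μ Λ σ :=
  Finset.single_le_sum (f := μ) (fun τ _ => hμ τ) (by simp)

lemma prAgree_congr (Λ : Finset V) {σ τ : V → Bool} (h : ∀ v ∈ Λ, σ v = τ v) :
    prAgree μ Λ σ = prAgree μ Λ τ := by
  unfold prAgree
  congr 1
  ext ω
  simp only [Finset.mem_filter, Finset.mem_univ, true_and]
  exact forall₂_congr fun v hv => by rw [h v hv]

lemma condD_apply (μ : (V → Bool) → ℝ) (B : Finset V) (σ τ : V → Bool) :
    condD μ B σ τ = if ∀ v, v ∉ B → τ v = σ v then μ τ / prAgree μ Bᶜ σ else 0 := by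
  unfold condD prAgree
  simp only [Finset.mem_compl]

lemma condD_nonneg (hμ : ∀ σ, 0 ≤ μ σ) (σ τ : V → Bool) : 0 ≤ condD μ B σ τ := by
  rw [condD_apply]
  split_ifs
  · exact div_nonneg (hμ τ) (prAgree_nonneg hμ _ _)
  · exact le_rfl

lemma condD_congr {σ τ : V → Bool} (h : ∀ v, v ∉ B → τ v = σ v) :
    condD μ B τ = condD μ B σ := by
  ext ω
  rw [condD_apply, condD_apply, prAgree_congr (σ := τ) (τ := σ) _ (by simpa using h)]
  congr 1
  exact propext (forall₂_congr fun v hv => by rw [h v hv])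

lemma isOutside_condMean (f : (V → Bool) → ℝ) : IsOutside B (condMean μ B f) := by
  intro σ τ h
  rw [condMean, condMean, condD_congr h]

lemma condMean_eq_div (f : (V → Bool) → ℝ) (σ : V → Bool) :
    condMean μ B f σ =
      (∑ τ, if ∀ v, v ∉ B → τ v = σ v then μ τ * f τ else 0) / prAgree μ Bᶜ σ := by
  rw [condMean, pmean, Finset.sum_div]
  refine Finset.sum_congr rfl fun τ _ => ?_
  rw [condD_apply]
  split_ifs <;> ring

lemma condMean_mul_left {h : (V → Bool) → ℝ} (hh : IsOutside B h) (f : (V → Bool) → ℝ)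
    (σ : V → Bool) : condMean μ B (fun τ => h τ * f τ) σ = h σ * condMean μ B f σ := by
  simp only [condMean, pmean, Finset.mul_sum]
  refine Finset.sum_congr rfl fun τ _ => ?_
  rw [condD_apply]
  split_ifs with hτ
  · rw [hh σ τ hτ]; ring
  · ring

lemma sum_condD (hμ : ∀ σ, 0 ≤ μ σ) {σ : V → Bool} (hσ : 0 < μ σ) :
    ∑ τ, condD μ B σ τ = 1 := by
  have hpos : 0 < prAgree μ Bᶜ σ := hσ.trans_le (le_prAgree hμ _ _)
  simp only [condD_apply]
  rw [← Finset.sum_filter, ← Finset.sum_div, div_eq_one_iff_eq hpos.ne', prAgree]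
  simp only [Finset.mem_compl]

lemma condMean_nonneg (hμ : ∀ σ, 0 ≤ μ σ) {f : (V → Bool) → ℝ} (hf : ∀ σ, 0 ≤ f σ)
    (σ : V → Bool) : 0 ≤ condMean μ B f σ :=
  Finset.sum_nonneg fun τ _ => mul_nonneg (condD_nonneg hμ σ τ) (hf τ)

lemma condMean_sub (f g : (V → Bool) → ℝ) (σ : V → Bool) :
    condMean μ B (fun τ => f τ - g τ) σ = condMean μ B f σ - condMean μ B g σ := by
  simp only [condMean, pmean, mul_sub, Finset.sum_sub_distrib]

lemma condMean_const (hμ : ∀ σ, 0 ≤ μ σ) {σ : V → Bool} (hσ : 0 < μ σ) (c : ℝ) :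
    condMean μ B (fun _ => c) σ = c := by
  rw [condMean, pmean, ← Finset.sum_mul, sum_condD hμ hσ, one_mul]

lemma condMean_pos (hμ : ∀ σ, 0 ≤ μ σ) {f : (V → Bool) → ℝ} (hf : ∀ σ, 0 ≤ f σ)
    {σ : V → Bool} (hσ : 0 < μ σ) (hfσ : 0 < f σ) : 0 < condMean μ B f σ := by
  refine Finset.sum_pos' (fun τ _ => mul_nonneg (condD_nonneg hμ σ τ) (hf τ))
    ⟨σ, Finset.mem_univ _, mul_pos ?_ hfσ⟩
  rw [condD_apply, if_pos fun _ _ => rfl]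
  exact div_pos hσ (hσ.trans_le (le_prAgree hμ _ _))

/-- The law of total expectation. -/
lemma pmean_condMean (hμ : ∀ σ, 0 ≤ μ σ) (f : (V → Bool) → ℝ) :
    pmean μ (condMean μ B f) = pmean μ f := by
  simp only [pmean, condMean, Finset.mul_sum]
  rw [Finset.sum_comm]
  refine Finset.sum_congr rfl fun τ _ => ?_
  rcases (hμ τ).eq_or_lt with hτ | hτ
  · refine (Finset.sum_eq_zero fun σ _ => ?_).trans (by rw [← hτ, zero_mul])
    rw [condD_apply, ← hτ]
    simp
  · rw [← one_mul (μ τ * f τ), ← sum_condD (B := B) hμ hτ, Finset.sum_mul]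
    refine Finset.sum_congr rfl fun σ _ => ?_
    rw [condD_apply, condD_apply]
    by_cases h : ∀ v, v ∉ B → σ v = τ v
    · rw [if_pos h, if_pos fun v hv => (h v hv).symm,
        prAgree_congr (σ := σ) (τ := τ) _ (by simpa using h)]
      ring
    · rw [if_neg h, if_neg fun h' => h fun v hv => (h' v hv).symm]
      ring

lemma condMean_condMean (hμ : ∀ σ, 0 ≤ μ σ) (hB : B ⊆ B') (f : (V → Bool) → ℝ)
    (σ : V → Bool) : condMean μ B' (condMean μ B f) σ = condMean μ B' f σ := by
  set h : (V → Bool) → ℝ := fun τ => if ∀ v, v ∉ B' → τ v = σ v then 1 else 0 with hh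
  have hout : IsOutside B' h := by
    intro τ ω hω
    simp only [hh]
    congr 1
    exact propext (forall₂_congr fun v hv => by rw [hω v hv])
  have key : ∀ g : (V → Bool) → ℝ,
      (∑ τ, if ∀ v, v ∉ B' → τ v = σ v then μ τ * g τ else 0) =
        pmean μ fun τ => h τ * g τ := by
    intro g
    refine Finset.sum_congr rfl fun τ _ => ?_
    simp only [hh]
    split_ifs <;> ring
  rw [condMean_eq_div, condMean_eq_div, key, key]
  congr 1
  rw [← pmean_condMean (B := B) hμ fun τ => h τ * f τ]
  congr 1
  ext τ
  rw [condMean_mul_left (hout.mono hB)]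

lemma pmean_mul_eq (hμ : ∀ σ, 0 ≤ μ σ) {h : (V → Bool) → ℝ} (hh : IsOutside B h)
    (f : (V → Bool) → ℝ) :
    pmean μ (fun σ => h σ * f σ) = pmean μ (fun σ => h σ * condMean μ B f σ) := by
  rw [← pmean_condMean (B := B) hμ]
  congr 1
  ext σ
  rw [condMean_mul_left hh]

/-- The averaged conditional entropy is the difference of two `x log x` functionals. -/
lemma pmean_pent_condD (hμ : ∀ σ, 0 ≤ μ σ) (f : (V → Bool) → ℝ) :
    pmean μ (fun σ => pent (condD μ B σ) f) =
      pmean μ (fun σ => f σ * Real.log (f σ)) -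
        pmean μ (fun σ => condMean μ B f σ * Real.log (condMean μ B f σ)) := by
  rw [← pmean_condMean (B := B) hμ fun σ => f σ * Real.log (f σ)]
  simp only [pmean, ← Finset.sum_sub_distrib, ← mul_sub]
  rfl

end CondExp

/-! ### Entropy inequalities -/

/-- The variational inequality behind nonnegativity of relative entropy. -/
lemma sub_le_mul_log_sub {x y : ℝ} (hx : 0 ≤ x) (hy : 0 ≤ y) (hxy : 0 < x → 0 < y) :
    x - y ≤ x * Real.log x - x * Real.log y := by
  rcases hx.eq_or_lt with rfl | hx
  · simpa using hy
  · have h := Real.log_le_sub_one_of_pos (div_pos (hxy hx) hx)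
    rw [Real.log_div (hxy hx).ne' hx.ne'] at h
    have h2 := mul_le_mul_of_nonneg_left h hx.le
    have h3 : x * (y / x - 1) = y - x := by field_simp
    linarith

lemma sq_sqrt_sub_le {x m : ℝ} (hx : 0 ≤ x) (hm : 0 < m) :
    (√x - √m) ^ 2 ≤ x * Real.log x - x * Real.log m - x + m := by
  rcases hx.eq_or_lt with rfl | hx
  · simp [Real.sq_sqrt hm.le]
  · have hsx := Real.sqrt_pos.2 hx
    have hsm := Real.sqrt_pos.2 hm
    have h := sub_le_mul_log_sub hsx.le hsm.le fun _ => hsm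
    rw [Real.log_sqrt hx.le, Real.log_sqrt hm.le] at h
    have h2 := mul_le_mul_of_nonneg_left h hsx.le
    nlinarith [Real.sq_sqrt hx.le, Real.sq_sqrt hm.le]

section Pinsker

variable {α : Type*} [Fintype α] {p g : α → ℝ}

lemma pent_eq_sum (hp1 : ∑ a, p a = 1) (g : α → ℝ) :
    pent p g = ∑ a, p a * (g a * Real.log (g a) - g a * Real.log (pmean p g) - g a +
      pmean p g) := by
  have h1 : ∑ a, p a * (g a * Real.log (pmean p g)) = pmean p g * Real.log (pmean p g) := by
    conv_rhs => lhs; rw [pmean]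
    rw [Finset.sum_mul]
    exact Finset.sum_congr rfl fun a _ => by ring
  have h2 : ∑ a, p a * pmean p g = pmean p g := by rw [← Finset.sum_mul, hp1, one_mul]
  have h3 : ∑ a, p a * g a = pmean p g := rfl
  simp only [mul_add, mul_sub, Finset.sum_add_distrib, Finset.sum_sub_distrib]
  rw [h1, h2, h3, pent]
  simp only [pmean]
  ring

lemma pent_nonneg (hp : ∀ a, 0 ≤ p a) (hp1 : ∑ a, p a = 1) (hg : ∀ a, 0 ≤ g a) :
    0 ≤ pent p g := by
  have hm : 0 ≤ pmean p g := Finset.sum_nonneg fun a _ => mul_nonneg (hp a) (hg a)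
  rw [pent_eq_sum hp1]
  refine Finset.sum_nonneg fun a _ => ?_
  rcases (hp a).eq_or_lt with h0 | hpos
  · rw [← h0, zero_mul]
  · have h := sub_le_mul_log_sub (hg a) hm fun hga =>
      Finset.sum_pos' (fun b _ => mul_nonneg (hp b) (hg b))
        ⟨a, Finset.mem_univ _, mul_pos hpos hga⟩
    exact mul_nonneg hpos.le (by linarith)

/-- Pinsker's inequality with a non-optimal constant. -/
lemma sq_mean_abs_sub_le (hp : ∀ a, 0 ≤ p a) (hp1 : ∑ a, p a = 1) (hg : ∀ a, 0 ≤ g a)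
    (hm : 0 < pmean p g) :
    (pmean p fun a => |g a - pmean p g|) ^ 2 ≤ 4 * pmean p g * pent p g := by
  set m := pmean p g with hmdef
  have h1 : ∑ a, p a * (√(g a) - √m) ^ 2 ≤ pent p g := by
    rw [pent_eq_sum hp1]
    exact Finset.sum_le_sum fun a _ =>
      mul_le_mul_of_nonneg_left (sq_sqrt_sub_le (hg a) hm) (hp a)
  have h2 : ∑ a, p a * (√(g a) + √m) ^ 2 ≤ 4 * m := by
    calc ∑ a, p a * (√(g a) + √m) ^ 2 ≤ ∑ a, (2 * (p a * g a) + p a * (2 * m)) := by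
          refine Finset.sum_le_sum fun a _ => ?_
          have : (√(g a) + √m) ^ 2 ≤ 2 * g a + 2 * m := by
            nlinarith [Real.sq_sqrt (hg a), Real.sq_sqrt hm.le, sq_nonneg (√(g a) - √m)]
          nlinarith [mul_le_mul_of_nonneg_left this (hp a)]
      _ = 4 * m := by
          rw [Finset.sum_add_distrib, ← Finset.mul_sum, ← Finset.sum_mul, hp1]
          change 2 * pmean p g + _ = _
          rw [← hmdef]; ring
  have hcs := Finset.sum_mul_sq_le_sq_mul_sq Finset.univ
    (fun a => √(p a) * |√(g a) - √m|) (fun a => √(p a) * (√(g a) + √m))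
  have e1 : ∀ a, √(p a) * |√(g a) - √m| * (√(p a) * (√(g a) + √m)) = p a * |g a - m| := by
    intro a
    have : |g a - m| = |√(g a) - √m| * (√(g a) + √m) := by
      rw [← abs_of_nonneg (add_nonneg (Real.sqrt_nonneg (g a)) (Real.sqrt_nonneg m)),
        ← abs_mul]
      congr 1
      nlinarith [Real.sq_sqrt (hg a), Real.sq_sqrt hm.le]
    rw [this]
    linear_combination |√(g a) - √m| * (√(g a) + √m) * Real.mul_self_sqrt (hp a)
  simp only [e1, mul_pow, sq_abs, Real.sq_sqrt (hp _)] at hcs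
  have hE := pent_nonneg hp hp1 hg
  calc (pmean p fun a => |g a - m|) ^ 2
      ≤ (∑ a, p a * (√(g a) - √m) ^ 2) * ∑ a, p a * (√(g a) + √m) ^ 2 := hcs
    _ ≤ pent p g * (4 * m) := mul_le_mul h1 h2
        (Finset.sum_nonneg fun a _ => mul_nonneg (hp a) (sq_nonneg _)) hE
    _ = 4 * m * pent p g := by ring

end Pinsker

/-! ### Factorization under weak dependence -/

section Factorization

variable {μ : (V → Bool) → ℝ} {U A D : Finset V} {ε : ℝ}

/-- Bound on the correlation of the two block averages, conditionally outside `U`. -/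
lemma condMean_mul_condMean_div_le (hμ : ∀ σ, 0 ≤ μ σ) (hA : A ⊆ U) (hD : D ⊆ U)
    (hε : 0 ≤ ε)
    (hdep : ∀ ψ : (V → Bool) → ℝ, IsOutside A ψ → ∀ σ, 0 < μ σ →
      |condMean μ D ψ σ - condMean μ U ψ σ| ≤ ε * condMean μ U (fun τ => |ψ τ|) σ)
    {f : (V → Bool) → ℝ} (hf : ∀ σ, 0 ≤ f σ) {σ : V → Bool} (hσ : 0 < μ σ) :
    condMean μ U (fun τ => condMean μ D f τ * condMean μ A f τ) σ / condMean μ U f σ ≤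
      condMean μ U f σ + 2 * ε * (pent (condD μ U σ) (condMean μ D f) +
        pent (condD μ U σ) (condMean μ A f)) := by
  have hν := condD_nonneg (B := U) hμ σ
  have hν1 := sum_condD (B := U) hμ hσ
  have hmD := condMean_nonneg (B := D) hμ hf
  have hmA := condMean_nonneg (B := A) hμ hf
  have hED := pent_nonneg hν hν1 hmD
  have hEA := pent_nonneg hν hν1 hmA
  have hmeanD : pmean (condD μ U σ) (condMean μ D f) = condMean μ U f σ :=
    condMean_condMean hμ hD f σ
  have hmeanA : pmean (condD μ U σ) (condMean μ A f) = condMean μ U f σ :=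
    condMean_condMean hμ hA f σ
  rcases (condMean_nonneg (B := U) hμ hf σ).eq_or_lt with hc | hc
  · rw [← hc]
    simp only [div_zero, zero_add]
    positivity
  set c := condMean μ U f σ with hcdef
  have hPD := sq_mean_abs_sub_le hν hν1 hmD (by rw [hmeanD]; exact hc)
  have hPA := sq_mean_abs_sub_le hν hν1 hmA (by rw [hmeanA]; exact hc)
  rw [hmeanD] at hPD
  rw [hmeanA] at hPA
  set a := pmean (condD μ U σ) (fun τ => |condMean μ D f τ - c|)
  set b := pmean (condD μ U σ) (fun τ => |condMean μ A f τ - c|)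
  have hcov : condMean μ U (fun τ => condMean μ D f τ * condMean μ A f τ) σ - c * c =
      pmean (condD μ U σ) fun τ =>
        (condMean μ D f τ - c) * (condMean μ D (condMean μ A f) τ - c) := by
    have h1 : condMean μ U (fun τ => condMean μ D f τ * condMean μ A f τ) σ =
        pmean (condD μ U σ) fun τ => condMean μ D f τ * condMean μ D (condMean μ A f) τ := by
      rw [← condMean_condMean hμ hD]
      change pmean _ _ = _
      congr 1
      ext τ
      rw [condMean_mul_left (isOutside_condMean f)]
    have h2 : pmean (condD μ U σ) (condMean μ D (condMean μ A f)) = c := by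
      rw [← hmeanA]
      exact condMean_condMean hμ hD _ σ
    rw [h1]
    simp only [pmean] at hmeanD h2 ⊢
    calc _ = ∑ τ, condD μ U σ τ * (condMean μ D f τ * condMean μ D (condMean μ A f) τ)
          - (∑ τ, condD μ U σ τ * condMean μ D f τ) * c
          - c * (∑ τ, condD μ U σ τ * condMean μ D (condMean μ A f) τ)
          + (∑ τ, condD μ U σ τ) * (c * c) := by rw [hmeanD, h2, hν1]; ring
      _ = _ := by
          simp only [Finset.mul_sum, Finset.sum_mul, ← Finset.sum_add_distrib,
            ← Finset.sum_sub_distrib]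
          exact Finset.sum_congr rfl fun τ _ => by ring
  have hbound : pmean (condD μ U σ) (fun τ =>
        (condMean μ D f τ - c) * (condMean μ D (condMean μ A f) τ - c)) ≤ a * (ε * b) := by
    change ∑ τ, _ ≤ (∑ τ, _) * (ε * b)
    rw [Finset.sum_mul]
    refine Finset.sum_le_sum fun τ _ => ?_
    rw [mul_assoc]
    by_cases hτ : (∀ v, v ∉ U → τ v = σ v) ∧ 0 < μ τ
    · refine mul_le_mul_of_nonneg_left ?_ (hν τ)
      refine (le_abs_self _).trans ?_
      rw [abs_mul]
      refine mul_le_mul_of_nonneg_left ?_ (abs_nonneg _)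
      have h := hdep (fun ω => condMean μ A f ω - c)
        (fun ω ω' h => by simp only [isOutside_condMean f ω ω' h]) τ hτ.2
      rw [condMean_sub, condMean_sub, condMean_const hμ hτ.2, condMean_const hμ hτ.2,
        condMean_condMean hμ hA, isOutside_condMean f σ τ hτ.1, ← hcdef, sub_self, sub_zero,
        isOutside_condMean _ σ τ hτ.1] at h
      exact h
    · have h0 : condD μ U σ τ = 0 := by
        rw [condD_apply]
        split_ifs with h
        · have : μ τ = 0 := le_antisymm (not_lt.1 fun h' => hτ ⟨h, h'⟩) (hμ τ)
          rw [this, zero_div]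
        · rfl
      rw [h0, zero_mul, zero_mul]
  rw [div_le_iff₀ hc]
  nlinarith [mul_nonneg hε (sq_nonneg (a - b)), mul_le_mul_of_nonneg_left hPD hε,
    mul_le_mul_of_nonneg_left hPA hε]

/-- If functions outside `A` are nearly independent of the configuration outside `D`, then the
entropy on `U ⊇ A ∪ D` almost factorizes. -/
lemma block_factorization_of_dependence_le (hμ : ∀ σ, 0 ≤ μ σ) (hA : A ⊆ U) (hD : D ⊆ U)
    {γ : ℝ} (hγ : 10 ≤ γ) (hε : 0 ≤ ε) (hεγ : ε ≤ 1 / (4 * γ))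
    (hdep : ∀ ψ : (V → Bool) → ℝ, IsOutside A ψ → ∀ σ, 0 < μ σ →
      |condMean μ D ψ σ - condMean μ U ψ σ| ≤ ε * condMean μ U (fun τ => |ψ τ|) σ)
    {f : (V → Bool) → ℝ} (hf : ∀ σ, 0 ≤ f σ) :
    pmean μ (fun σ => pent (condD μ U σ) f) ≤
      Real.exp (1 / γ) * (pmean μ (fun σ => pent (condD μ A σ) f) +
        pmean μ (fun σ => pent (condD μ D σ) f)) := by
  set ell : Finset V → ℝ := fun B =>
    pmean μ (fun σ => condMean μ B f σ * Real.log (condMean μ B f σ)) with hell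
  have hlog : ∀ B : Finset V, pmean μ (fun σ => f σ * Real.log (condMean μ B f σ)) = ell B := by
    intro B
    have h := pmean_mul_eq (B := B) hμ
      (h := fun σ => Real.log (condMean μ B f σ))
      (fun σ τ hστ => by simp only [isOutside_condMean f σ τ hστ]) f
    simp only [hell, mul_comm (f _), h]
    congr 1
    ext σ
    ring
  have hent : ∀ B ⊆ U, pmean μ (fun σ => pent (condD μ U σ) (condMean μ B f)) =
      ell B - ell U := by
    intro B hB
    rw [pmean_pent_condD hμ]
    simp only [condMean_condMean hμ hB]
    rfl
  have hent_nonneg : ∀ B ⊆ U, 0 ≤ ell B - ell U := by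
    intro B hB
    rw [← hent B hB]
    refine Finset.sum_nonneg fun σ _ => ?_
    rcases (hμ σ).eq_or_lt with h0 | hσ
    · rw [← h0, zero_mul]
    · exact mul_nonneg hσ.le (pent_nonneg (condD_nonneg hμ σ) (sum_condD hμ hσ)
        (condMean_nonneg hμ hf))
  have hmain : pmean μ (fun σ => f σ * Real.log (f σ)) - ell D - ell A + ell U ≥
      pmean μ f - pmean μ
        (fun σ => condMean μ D f σ * condMean μ A f σ / condMean μ U f σ) := by
    rw [← hlog D, ← hlog A, ← hlog U]
    simp only [pmean, ← Finset.sum_sub_distrib, ← Finset.sum_add_distrib, ge_iff_le]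
    refine Finset.sum_le_sum fun σ _ => ?_
    rcases (hμ σ).eq_or_lt with h0 | hσ
    · simp [← h0]
    have hD0 := condMean_nonneg (B := D) hμ hf σ
    have hA0 := condMean_nonneg (B := A) hμ hf σ
    have hU0 := condMean_nonneg (B := U) hμ hf σ
    have h := sub_le_mul_log_sub (hf σ) (div_nonneg (mul_nonneg hD0 hA0) hU0) fun h =>
      div_pos (mul_pos (condMean_pos hμ hf hσ h) (condMean_pos hμ hf hσ h))
        (condMean_pos hμ hf hσ h)
    have h2 : f σ * Real.log (condMean μ D f σ * condMean μ A f σ / condMean μ U f σ) =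
        f σ * (Real.log (condMean μ D f σ) + Real.log (condMean μ A f σ) -
          Real.log (condMean μ U f σ)) := by
      rcases (hf σ).eq_or_lt with h0 | h
      · simp [← h0]
      · have hD1 := condMean_pos (B := D) hμ hf hσ h
        have hA1 := condMean_pos (B := A) hμ hf hσ h
        have hU1 := condMean_pos (B := U) hμ hf hσ h
        rw [Real.log_div (mul_pos hD1 hA1).ne' hU1.ne', Real.log_mul hD1.ne' hA1.ne']
    rw [h2] at h
    have := mul_le_mul_of_nonneg_left h hσ.le
    linarith
  have hcorr : pmean μ
        (fun σ => condMean μ D f σ * condMean μ A f σ / condMean μ U f σ) ≤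
      pmean μ f + 2 * ε * ((ell D - ell U) + (ell A - ell U)) := by
    rw [← hent D hD, ← hent A hA, ← pmean_condMean (B := U) hμ f,
      ← pmean_condMean (B := U) hμ
        (fun σ => condMean μ D f σ * condMean μ A f σ / condMean μ U f σ)]
    simp only [pmean, Finset.mul_sum, ← Finset.sum_add_distrib]
    refine Finset.sum_le_sum fun σ _ => ?_
    rcases (hμ σ).eq_or_lt with h0 | hσ
    · simp [← h0]
    have h := condMean_mul_condMean_div_le hμ hA hD hε hdep hf hσ
    have h2 : condMean μ U
        (fun σ => condMean μ D f σ * condMean μ A f σ / condMean μ U f σ) σ =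
        condMean μ U (fun τ => condMean μ D f τ * condMean μ A f τ) σ / condMean μ U f σ := by
      have := condMean_mul_left (μ := μ) (B := U) (h := fun τ => (condMean μ U f τ)⁻¹)
        (fun τ ω hω => by simp only [isOutside_condMean f τ ω hω])
        (fun τ => condMean μ D f τ * condMean μ A f τ) σ
      simp only [div_eq_mul_inv]
      rw [mul_comm _ (condMean μ U f σ)⁻¹, ← this]
      simp only [mul_comm]
    rw [h2]
    have := mul_le_mul_of_nonneg_left h hσ.le
    simp only [pent, pmean] at this ⊢
    linarith
  rw [pmean_pent_condD hμ, pmean_pent_condD hμ, pmean_pent_condD hμ]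
  change _ - ell U ≤ _ * ((_ - ell A) + (_ - ell D))
  set F := pmean μ (fun σ => f σ * Real.log (f σ))
  have hYD := hent_nonneg D hD
  have hYA := hent_nonneg A hA
  have hγ0 : 0 < γ := by linarith
  set t := 1 / (2 * γ) with ht
  have ht0 : 0 < t := by positivity
  have ht1 : t ≤ 1 / 20 := by
    rw [ht]
    exact one_div_le_one_div_of_le (by norm_num) (by linarith)
  have hεt : 2 * ε ≤ t := by
    have : 1 / (4 * γ) * 2 = t := by rw [ht]; field_simp; norm_num
    linarith
  have hexp : 1 + 2 * t ≤ Real.exp (1 / γ) := by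
    have h := Real.add_one_le_exp (1 / γ)
    have : 2 * t = 1 / γ := by rw [ht]; field_simp
    linarith
  set X := F - ell U with hX
  set Y := (ell D - ell U) + (ell A - ell U) with hY
  have hY0 : 0 ≤ Y := add_nonneg hYD hYA
  have hXY : (1 - t) * Y ≤ X := by
    have := mul_le_mul_of_nonneg_right hεt hY0
    linarith
  have hfac : (1 + 2 * t) * (2 * X - Y) ≥ X := by
    nlinarith [mul_le_mul_of_nonneg_left hXY (by linarith : 0 ≤ 1 + 4 * t),
      mul_nonneg (mul_nonneg ht0.le (by linarith : 0 ≤ 1 - 4 * t)) hY0]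
  have h2 : 0 ≤ 2 * X - Y := by nlinarith
  have h3 : F - ell A + (F - ell D) = 2 * X - Y := by rw [hX, hY]; ring
  rw [h3]
  exact hfac.trans (mul_le_mul_of_nonneg_right hexp h2)

end Factorization

/-! ### Ratio bounds from strong spatial mixing -/

section Mixing

/-- Cross-ratio bounds for two weights bound the difference of the corresponding means. -/
lemma abs_weighted_mean_sub_le {ι : Type*} [Fintype ι] {a b : ι → ℝ} {M : ℝ}
    (hM : 1 ≤ M) (hb : ∀ i, 0 ≤ b i) (ha1 : 0 < ∑ i, a i)
    (hb1 : 0 < ∑ i, b i) (hab : ∀ i j, a i * b j ≤ M * (a j * b i)) (ψ : ι → ℝ) :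
    |(∑ i, a i * ψ i) / (∑ i, a i) - (∑ i, b i * ψ i) / (∑ i, b i)| ≤
      (M - 1) * ((∑ i, b i * |ψ i|) / (∑ i, b i)) := by
  set s := ∑ i, a i with hs
  set t := ∑ i, b i with ht
  have h1 : ∀ i, a i * t ≤ M * (s * b i) := by
    intro i
    rw [ht, hs, Finset.mul_sum, Finset.sum_mul, Finset.mul_sum]
    exact Finset.sum_le_sum fun j _ => hab i j
  have h2 : ∀ j, s * b j ≤ M * (a j * t) := by
    intro j
    rw [ht, hs, Finset.sum_mul, Finset.mul_sum, Finset.mul_sum]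
    exact Finset.sum_le_sum fun i _ => hab i j
  have h3 : ∀ i, |a i / s - b i / t| ≤ (M - 1) * (b i / t) := by
    intro i
    have k1 : a i / s ≤ M * (b i / t) := by
      rw [← mul_div_assoc, div_le_div_iff₀ ha1 hb1]
      linarith [h1 i]
    have k2 : b i / t ≤ M * (a i / s) := by
      rw [← mul_div_assoc, div_le_div_iff₀ hb1 ha1]
      linarith [h2 i]
    have k3 : 0 ≤ b i / t := div_nonneg (hb i) hb1.le
    rw [abs_le]
    refine ⟨?_, by linarith⟩
    have k4 : (2 - M) * (b i / t) ≤ a i / s := by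
      by_contra! hlt
      have : M * (a i / s) < M * ((2 - M) * (b i / t)) := by
        exact mul_lt_mul_of_pos_left hlt (by linarith)
      nlinarith [mul_nonneg (sq_nonneg (M - 1)) k3]
    linarith
  have e : (∑ i, a i * ψ i) / s - (∑ i, b i * ψ i) / t = ∑ i, (a i / s - b i / t) * ψ i := by
    rw [Finset.sum_div, Finset.sum_div, ← Finset.sum_sub_distrib]
    exact Finset.sum_congr rfl fun i _ => by ring
  rw [e, Finset.sum_div, Finset.mul_sum]
  refine (Finset.abs_sum_le_sum_abs _ _).trans (Finset.sum_le_sum fun i _ => ?_)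
  rw [abs_mul]
  calc _ ≤ (M - 1) * (b i / t) * |ψ i| := mul_le_mul_of_nonneg_right (h3 i) (abs_nonneg _)
    _ = _ := by ring

variable {μ : (V → Bool) → ℝ} {B T : Finset V}

/-- Decomposition of a sum over configurations according to their restriction to `T`. -/
lemma sum_mul_eq_sum_prAgree (hT : T ⊆ B) {σ : V → Bool} {ψ : (V → Bool) → ℝ}
    (hψ : ∀ τ τ' : V → Bool, (∀ v ∈ T, τ v = τ' v) → (∀ v, v ∉ B → τ v = τ' v) → ψ τ = ψ τ') :
    (∑ τ, if ∀ v, v ∉ B → τ v = σ v then μ τ * ψ τ else 0) =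
      ∑ z : V → Bool, (if ∀ v, v ∉ T → z v = σ v then prAgree μ (Bᶜ ∪ T) z else 0) * ψ z := by
  rw [← Finset.sum_filter,
    ← Finset.sum_fiberwise _ fun τ : V → Bool => fun v => if v ∈ T then τ v else σ v]
  refine Finset.sum_congr rfl fun z _ => ?_
  rw [Finset.filter_filter]
  split_ifs with hz
  · rw [prAgree, Finset.sum_mul]
    refine Finset.sum_congr ?_ fun τ hτ => ?_
    · ext τ
      simp only [Finset.mem_filter, Finset.mem_univ, true_and, Finset.mem_union,
        Finset.mem_compl, funext_iff]
      constructor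
      · rintro ⟨h1, h2⟩ v hv
        by_cases hvT : v ∈ T
        · simpa [hvT] using h2 v
        · rw [hz v hvT]
          exact h1 v (hv.resolve_right hvT)
      · intro h
        refine ⟨fun v hv => ?_, fun v => ?_⟩
        · rw [h v (Or.inl hv), hz v fun h' => hv (hT h')]
        · split_ifs with hvT
          · exact h v (Or.inr hvT)
          · exact (hz v hvT).symm
    · simp only [Finset.mem_filter, Finset.mem_univ, true_and, Finset.mem_union,
        Finset.mem_compl] at hτ
      rw [hψ τ z (fun v hv => hτ v (Or.inr hv)) fun v hv => hτ v (Or.inl hv)]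
  · rw [zero_mul]
    refine Finset.sum_eq_zero fun τ hτ => absurd ?_ hz
    simp only [Finset.mem_filter, Finset.mem_univ, true_and] at hτ
    intro v hv
    rw [← hτ.2]
    simp [hv]

lemma vmarg_condD_mul_prAgree (Λ : Finset V) (v : V) (θ : V → Bool)
    (hθ : prAgree μ Λ θ ≠ 0) :
    vmarg (condD μ Λᶜ θ) v (θ v) * prAgree μ Λ θ = prAgree μ (insert v Λ) θ := by
  conv_rhs => rw [prAgree]
  rw [vmarg, Finset.sum_mul, Finset.sum_filter, Finset.sum_filter]
  refine Finset.sum_congr rfl fun τ _ => ?_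
  rw [condD_apply, compl_compl]
  simp only [Finset.mem_compl, not_not, Finset.mem_insert, forall_eq_or_imp]
  by_cases h1 : τ v = θ v <;> by_cases h2 : ∀ u ∈ Λ, τ u = θ u
  · rw [if_pos h1, if_pos h2, if_pos ⟨h1, h2⟩, div_mul_cancel₀ _ hθ]
  · rw [if_pos h1, if_neg h2, if_neg fun h => h2 h.2, zero_mul]
  · rw [if_neg h1, if_neg fun h => h1 h.1]
  · rw [if_neg h1, if_neg fun h => h1 h.1]

variable {G : SimpleGraph V} {lam Cssm δ : ℝ} {S U : Finset V} {r : ℕ}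

/-- Under strong spatial mixing, the law of the spins in `S'` is insensitive, up to a factor,
to the pinning far away from `S`. -/
lemma prAgree_cross_le (hμ : ∀ σ, 0 ≤ hcMu G lam σ) (hssm : hcSSM G lam Cssm δ)
    (hSU : S ⊆ U) (hη : Cssm * (1 - δ) ^ r < 1) (hη0 : 0 ≤ Cssm * (1 - δ) ^ r)
    {z z' : V → Bool} (hz : ∀ v, v ∉ U \ ballUr G U S r → z v = z' v)
    {S' : Finset V} (hS' : S' ⊆ S) :
    prAgree (hcMu G lam) ((Uᶜ ∪ S') ∪ (U \ ballUr G U S r)) z *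
        prAgree (hcMu G lam) (Uᶜ ∪ (U \ ballUr G U S r)) z' ≤
      (1 + Cssm * (1 - δ) ^ r) ^ S'.card *
        (prAgree (hcMu G lam) ((Uᶜ ∪ S') ∪ (U \ ballUr G U S r)) z' *
          prAgree (hcMu G lam) (Uᶜ ∪ (U \ ballUr G U S r)) z) := by
  set μ := hcMu G lam
  set W := U \ ballUr G U S r with hW
  set η := Cssm * (1 - δ) ^ r with hηdef
  induction S' using Finset.induction_on with
  | empty =>
    simp only [Finset.union_empty, Finset.card_empty, pow_zero, one_mul]
    exact (mul_comm _ _).le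
  | insert s S' hs ih =>
    have hsS : s ∈ S := hS' (Finset.mem_insert_self _ _)
    specialize ih fun v hv => hS' (Finset.mem_insert_of_mem hv)
    have hball : ∀ v ∈ S, v ∉ W := fun v hv hvW =>
      (Finset.mem_sdiff.1 hvW).2
        (Finset.mem_filter.2 ⟨hSU hv, v, hv, SimpleGraph.Walk.nil, Nat.zero_le _⟩)
    have hins : (Uᶜ ∪ insert s S') ∪ W = insert s ((Uᶜ ∪ S') ∪ W) := by
      rw [Finset.union_insert, Finset.insert_union]
    rw [Finset.card_insert_of_notMem hs, hins]
    set Λ := Uᶜ ∪ S' with hΛ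
    set N₀ := prAgree μ (Uᶜ ∪ W) z
    set N₀' := prAgree μ (Uᶜ ∪ W) z'
    have hN₀ : 0 ≤ N₀ := prAgree_nonneg hμ _ _
    have hN₀' : 0 ≤ N₀' := prAgree_nonneg hμ _ _
    have hrhs : 0 ≤ (1 + η) ^ (S'.card + 1) * (prAgree μ (insert s (Λ ∪ W)) z' * N₀) :=
      mul_nonneg (by positivity) (mul_nonneg (prAgree_nonneg hμ _ _) hN₀)
    rcases (prAgree_nonneg hμ (insert s (Λ ∪ W)) z).eq_or_lt with h0 | hpos
    · rw [← h0, zero_mul]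
      exact hrhs
    have hposΛ : 0 < prAgree μ (Λ ∪ W) z :=
      hpos.trans_le (prAgree_anti hμ (Finset.subset_insert _ _) z)
    rcases hN₀'.eq_or_lt with h0 | hN₀'pos
    · rw [← h0, mul_zero]
      exact hrhs
    have hposΛ' : 0 < prAgree μ (Λ ∪ W) z' := by
      refine (prAgree_nonneg hμ _ _).lt_of_ne' fun h0 => ?_
      rw [h0, zero_mul, mul_zero] at ih
      exact absurd ih (not_le.2 (mul_pos hposΛ hN₀'pos))
    have hsΛ : s ∉ Λ := by
      rw [hΛ, Finset.mem_union, Finset.mem_compl, not_or, not_not]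
      exact ⟨hSU hsS, hs⟩
    have hdisj : Disjoint Λ W := by
      rw [Finset.disjoint_left]
      intro v hv hvW
      rcases Finset.mem_union.1 hv with hv | hv
      · exact Finset.mem_compl.1 hv (Finset.mem_sdiff.1 hvW).1
      · exact hball v (hS' (Finset.mem_insert_of_mem hv)) hvW
    have hfeas : 0 < vmarg (condD μ Λᶜ z) s (z s) := by
      have hΛpos : 0 < prAgree μ Λ z :=
        hposΛ.trans_le (prAgree_anti hμ Finset.subset_union_left z)
      have h := vmarg_condD_mul_prAgree Λ s z hΛpos.ne'
      have h2 : 0 < prAgree μ (insert s Λ) z := hpos.trans_le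
        (prAgree_anti hμ (Finset.insert_subset_insert _ Finset.subset_union_left) z)
      rw [← h] at h2
      exact pos_of_mul_pos_left h2 hΛpos.le
    have hmix := hssm Λ W s hsΛ (hball s hsS) hdisj z z'
      (fun u hu => hz u fun huW => Finset.disjoint_left.1 hdisj hu huW)
      hposΛ hposΛ' (z s) hfeas r
      (fun u hu w => by
        by_contra! hlt
        refine (Finset.mem_sdiff.1 hu).2 (Finset.mem_filter.2
          ⟨(Finset.mem_sdiff.1 hu).1, s, hsS, w.reverse, ?_⟩)
        rw [SimpleGraph.Walk.length_reverse]
        exact hlt.le)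
    have hzs : z s = z' s := hz s (hball s hsS)
    have e1 := vmarg_condD_mul_prAgree (Λ ∪ W) s z hposΛ.ne'
    have e2 := vmarg_condD_mul_prAgree (Λ ∪ W) s z' hposΛ'.ne'
    rw [← hzs] at e2
    set m₁ := vmarg (condD μ (Λ ∪ W)ᶜ z) s (z s)
    set m₂ := vmarg (condD μ (Λ ∪ W)ᶜ z') s (z s)
    have hm₂ : 0 ≤ m₂ := Finset.sum_nonneg fun τ _ => condD_nonneg hμ _ _
    have hm₂pos : 0 < m₂ := by
      refine hm₂.lt_of_ne' fun h0 => ?_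
      rw [h0, div_zero, zero_sub, abs_neg, abs_one] at hmix
      exact absurd hmix (not_le.2 hη)
    have hm : m₁ ≤ (1 + η) * m₂ := by
      have := (abs_le.1 hmix).2
      rw [← div_le_iff₀ hm₂pos]
      linarith
    rw [← e1, ← e2]
    have hprod : 0 ≤ prAgree μ (Λ ∪ W) z * N₀' := mul_nonneg hposΛ.le hN₀'
    calc m₁ * prAgree μ (Λ ∪ W) z * N₀' = m₁ * (prAgree μ (Λ ∪ W) z * N₀') := by ring
      _ ≤ ((1 + η) * m₂) * (prAgree μ (Λ ∪ W) z * N₀') :=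
          mul_le_mul_of_nonneg_right hm hprod
      _ ≤ ((1 + η) * m₂) * ((1 + η) ^ S'.card * (prAgree μ (Λ ∪ W) z' * N₀)) :=
          mul_le_mul_of_nonneg_left ih (mul_nonneg (by linarith) hm₂)
      _ = _ := by ring

lemma abs_condMean_sub_condMean_le (hμ : ∀ σ, 0 ≤ hcMu G lam σ) (hssm : hcSSM G lam Cssm δ)
    (hSU : S ⊆ U) (hη : Cssm * (1 - δ) ^ r < 1) (hη0 : 0 ≤ Cssm * (1 - δ) ^ r)
    {ψ : (V → Bool) → ℝ} (hψ : IsOutside (ballUr G U S r) ψ) {σ : V → Bool}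
    (hσ : 0 < hcMu G lam σ) :
    |condMean (hcMu G lam) (U \ S) ψ σ - condMean (hcMu G lam) U ψ σ| ≤
      ((1 + Cssm * (1 - δ) ^ r) ^ S.card - 1) *
        condMean (hcMu G lam) U (fun τ => |ψ τ|) σ := by
  set μ := hcMu G lam
  set T := U \ ballUr G U S r with hT
  have hSball : S ⊆ ballUr G U S r := fun v hv =>
    Finset.mem_filter.2 ⟨hSU hv, v, hv, SimpleGraph.Walk.nil, Nat.zero_le _⟩
  have hTU : T ⊆ U := Finset.sdiff_subset
  have hTD : T ⊆ U \ S := Finset.sdiff_subset_sdiff le_rfl hSball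
  have hDc : (U \ S)ᶜ = Uᶜ ∪ S := by
    ext v
    simp only [Finset.mem_compl, Finset.mem_sdiff, Finset.mem_union]
    tauto
  have hdet : ∀ τ τ' : V → Bool, (∀ v ∈ T, τ v = τ' v) → (∀ v, v ∉ U → τ v = τ' v) →
      ψ τ = ψ τ' := by
    intro τ τ' h1 h2
    refine hψ τ' τ fun v hv => ?_
    by_cases hvU : v ∈ U
    · exact h1 v (Finset.mem_sdiff.2 ⟨hvU, hv⟩)
    · exact h2 v hvU
  have hdetD : ∀ τ τ' : V → Bool, (∀ v ∈ T, τ v = τ' v) →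
      (∀ v, v ∉ U \ S → τ v = τ' v) → ψ τ = ψ τ' := fun τ τ' h1 h2 =>
    hdet τ τ' h1 fun v hv => h2 v fun h => hv (Finset.mem_sdiff.1 h).1
  have hnorm : ∀ B : Finset V, T ⊆ B → prAgree μ Bᶜ σ =
      ∑ z : V → Bool, if ∀ v, v ∉ T → z v = σ v then prAgree μ (Bᶜ ∪ T) z else 0 := by
    intro B hB
    have h := sum_mul_eq_sum_prAgree (μ := μ) hB (σ := σ) (ψ := fun _ => 1)
      fun _ _ _ _ => rfl
    simp only [mul_one] at h
    rw [← h, prAgree, Finset.sum_filter]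
    simp only [Finset.mem_compl]
  have hposN : ∀ Λ : Finset V, 0 < prAgree μ Λ σ := fun Λ => hσ.trans_le (le_prAgree hμ _ _)
  rw [condMean_eq_div, condMean_eq_div, condMean_eq_div,
    sum_mul_eq_sum_prAgree hTD hdetD, sum_mul_eq_sum_prAgree hTU hdet,
    sum_mul_eq_sum_prAgree hTU (ψ := fun τ => |ψ τ|) (fun τ τ' h1 h2 => by
      simp only [hdet τ τ' h1 h2]), hnorm _ hTD, hnorm _ hTU]
  refine abs_weighted_mean_sub_le (one_le_pow₀ (by linarith)) ?_ ?_ ?_ ?_ ψ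
  · intro z
    split_ifs
    · exact prAgree_nonneg hμ _ _
    · exact le_rfl
  · rw [← hnorm _ hTD]
    exact hposN _
  · rw [← hnorm _ hTU]
    exact hposN _
  · intro z z'
    by_cases hz : ∀ v, v ∉ T → z v = σ v
    · by_cases hz' : ∀ v, v ∉ T → z' v = σ v
      · simp only [if_pos hz, if_pos hz', hDc]
        exact prAgree_cross_le hμ hssm hSU hη hη0
          (fun v hv => (hz v hv).trans (hz' v hv).symm) (Finset.Subset.refl S)
      · simp only [if_neg hz', mul_zero, zero_mul, le_refl]
    · simp only [if_neg hz, mul_zero, zero_mul, le_refl]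

end Mixing

lemma hcMu_nonneg (G : SimpleGraph V) {lam : ℝ} (hlam : 0 < lam) (σ : V → Bool) :
    0 ≤ hcMu G lam σ := by
  have h : ∀ τ, 0 ≤ hcW G lam τ := fun τ => by
    unfold hcW
    split_ifs
    · positivity
    · exact le_rfl
  exact div_nonneg (h σ) (Finset.sum_nonneg fun τ _ => h τ)

/-- Beyond logarithmic distance the accumulated mixing error is small. -/
lemma card_mul_decay_le {Cssm δ γ n : ℝ} (hC : 0 < Cssm) (hδ0 : 0 < δ) (hδ1 : δ < 1)
    (hγ : 10 ≤ γ) (hn : 1 ≤ n) {r : ℕ}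
    (hr : (1 + |Real.log (8 * Cssm)|) / (-Real.log (1 - δ)) * (Real.log n + Real.log γ) ≤ r) :
    n * (Cssm * (1 - δ) ^ r) ≤ 1 / (8 * γ) := by
  have hδ : 0 < 1 - δ := by linarith
  have hlog : 0 < -Real.log (1 - δ) := by
    have := Real.log_neg hδ (by linarith)
    linarith
  have hlogn : 0 ≤ Real.log n := Real.log_nonneg hn
  have hlogγ : 1 ≤ Real.log γ := by
    rw [Real.le_log_iff_exp_le (by linarith)]
    linarith [Real.exp_one_lt_d9]
  have hγ0 : 0 < γ := by linarith
  rw [div_mul_eq_mul_div, div_le_iff₀ hlog] at hr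
  have h1 : Real.log (8 * Cssm) + Real.log n + Real.log γ + r * Real.log (1 - δ) ≤ 0 := by
    nlinarith [le_abs_self (Real.log (8 * Cssm)), abs_nonneg (Real.log (8 * Cssm))]
  have h2 : Real.log (8 * Cssm * n * γ * (1 - δ) ^ r) ≤ 0 := by
    rw [Real.log_mul (by positivity) (by positivity), Real.log_mul (by positivity) hγ0.ne',
      Real.log_mul (by positivity) (by linarith), Real.log_pow]
    exact h1
  have h3 : 8 * Cssm * n * γ * (1 - δ) ^ r ≤ 1 :=
    (Real.log_nonpos_iff (by positivity)).1 h2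
  rw [le_div_iff₀ (by positivity)]
  linarith

/-- **SSM implies block factorization of entropy with overlapping balls.**
For all `Cssm > 0` and `δ ∈ (0,1)` there is a constant `ρ > 0` such that: for every
graph `G` and fugacity `λ > 0` for which the hardcore model satisfies SSM with
parameters `(Cssm, δ)`, every nonempty `S ⊆ U ⊆ V`, every `γ ≥ 10` and every integer
`r ≥ ρ(log|S| + log γ)`, every nonnegative `f` satisfies
`E[Ent_U f] ≤ e^{1/γ} (E[Ent_{B_U(S,r)} f] + E[Ent_{U∖S} f])`. -/
theorem ssm_implies_ball_block_factorization_of_entropy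
    (Cssm δ : ℝ) (hC : 0 < Cssm) (hδ0 : 0 < δ) (hδ1 : δ < 1) :
    ∃ ρ : ℝ, 0 < ρ ∧
      ∀ (V : Type) [Fintype V] [DecidableEq V],
      ∀ (G : SimpleGraph V) (lam : ℝ), 0 < lam →
        hcSSM G lam Cssm δ →
        ∀ S U : Finset V, S.Nonempty → S ⊆ U →
        ∀ γ : ℝ, 10 ≤ γ →
        ∀ r : ℕ, ρ * (Real.log (S.card : ℝ) + Real.log γ) ≤ (r : ℝ) →
        ∀ f : (V → Bool) → ℝ, (∀ σ, 0 ≤ f σ) →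
          pmean (hcMu G lam) (fun σ => pent (condD (hcMu G lam) U σ) f) ≤
            Real.exp (1 / γ) *
              (pmean (hcMu G lam)
                  (fun σ => pent (condD (hcMu G lam) (ballUr G U S r) σ) f) +
               pmean (hcMu G lam)
                  (fun σ => pent (condD (hcMu G lam) (U \ S) σ) f)) := by
  have hlog : 0 < -Real.log (1 - δ) := by
    have := Real.log_neg (by linarith : (0 : ℝ) < 1 - δ) (by linarith)
    linarith
  refine ⟨(1 + |Real.log (8 * Cssm)|) / (-Real.log (1 - δ)), by positivity, ?_⟩
  intro V _ _ G lam hlam hssm S U hS hSU γ hγ r hr f hf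
  have hμ := hcMu_nonneg G hlam
  have hcard : (1 : ℝ) ≤ S.card := by exact_mod_cast hS.card_pos
  have hγ0 : 0 < γ := by linarith
  have hη0 : 0 ≤ Cssm * (1 - δ) ^ r := mul_nonneg hC.le (pow_nonneg (by linarith) r)
  have hdecay := card_mul_decay_le hC hδ0 hδ1 hγ hcard hr
  have hsmall : 1 / (8 * γ) ≤ 1 / 80 :=
    one_div_le_one_div_of_le (by norm_num) (by linarith)
  have hη : Cssm * (1 - δ) ^ r < 1 := by nlinarith
  set η := Cssm * (1 - δ) ^ r with hηdef
  refine block_factorization_of_dependence_le (ε := (1 + η) ^ S.card - 1) hμ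
    (Finset.filter_subset _ _) Finset.sdiff_subset hγ
    (sub_nonneg.2 (one_le_pow₀ (by linarith))) ?_
    (fun ψ hψ σ hσ => abs_condMean_sub_condMean_le hμ hssm hSU hη hη0 hψ hσ) hf
  have h1 : (1 + η) ^ S.card ≤ Real.exp (S.card * η) := by
    rw [Real.exp_nat_mul]
    exact pow_le_pow_left₀ (by linarith) (by linarith [Real.add_one_le_exp η]) _
  have ht0 : 0 ≤ S.card * η := by positivity
  have h2 := Real.abs_exp_sub_one_le (x := S.card * η) (by rw [abs_of_nonneg ht0]; linarith)
  rw [abs_of_nonneg ht0] at h2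
  have h3 : 2 * (1 / (8 * γ)) = 1 / (4 * γ) := by field_simp; norm_num
  linarith [le_abs_self (Real.exp (S.card * η) - 1)]

end
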